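/- arXiv:math/0701380 — 3 statements merged into one kernel-verified Lean document; each statement's English description precedes it below -/
import Mathlib

section
/- Let k be a field and V a cosimplicial k-vector space. For every n-simplex λ of Δ the map Υ(λ) : k ↦ λ(k n)(λ_k) is order-preserving, hence a morphism [n] → λ(n) of Δ; moreover, for every morphism φ : [m] → [n] of Δ and every n-simplex λ of Δ, Υ(λ) ∘ φ = λ(φ(m) n) ∘ Υ(λ∘φ) as morphisms [m] → λ(n) of Δ. Consequently the maps ιⁿ : Vⁿ → V̂ⁿ, ι(v)(λ) = V(Υ(λ))(v), satisfy φ_* ∘ ιᵐ = ιⁿ ∘ V(φ), i.e., ι : V → V̂ is a morphism of cosimplicial k-vector spaces, and induces a morphism of cochain complexes ι : C•(V) → C•(V̂). -/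
open CategoryTheory

/-- An `n`-simplex of the simplex category `Δ`: a functor `[n] → Δ`. -/
abbrev DeltaSimplex (n : ℕ) := ComposableArrows SimplexCategory n

/-- For a morphism `φ : [m] → [n]` of `Δ` and an `n`-simplex `λ` of `Δ`, the `m`-simplex
`λ ∘ φ`. -/
def DeltaSimplex.reindex {m n : ℕ} (φ : SimplexCategory.mk m ⟶ SimplexCategory.mk n)
    (lam : DeltaSimplex n) : DeltaSimplex m :=
  φ.toOrderHom.monotone.functor ⋙ lam

/-- The underlying map of `Υ(λ) : [n] → λ(n)`, given by `k ↦ λ(k n)(λ_k)`, the image of the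
top element `λ_k` of `λ(k)` under `λ(k n)`. -/
def upsilonFun {n : ℕ} (lam : DeltaSimplex n) (i : Fin (n + 1)) :
    Fin ((lam.obj (Fin.last n)).len + 1) :=
  (lam.map (homOfLE (Fin.le_last i))).toOrderHom (Fin.last _)

/-- `Υ(λ) : [n] → λ(n)` as a morphism of `Δ`. -/
def upsilonHom {n : ℕ} (lam : DeltaSimplex n) :
    SimplexCategory.mk n ⟶ lam.obj (Fin.last n) :=
  SimplexCategory.Hom.mk
    ⟨upsilonFun lam, by
      intro i j hij
      have e : lam.map (homOfLE (Fin.le_last i)) =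
          lam.map (homOfLE hij) ≫ lam.map (homOfLE (Fin.le_last j)) := by
        rw [← lam.map_comp]; exact congrArg lam.map (Subsingleton.elim _ _)
      show upsilonFun lam i ≤ upsilonFun lam j
      unfold upsilonFun
      rw [e]
      simp only [SimplexCategory.comp_toOrderHom, OrderHom.comp_coe, Function.comp_apply]
      exact (lam.map (homOfLE (Fin.le_last j))).toOrderHom.monotone (Fin.le_last _)⟩

variable {k : Type} [Field k]

/-- `V̂ⁿ = ∏_λ V^{λ(n)}`. -/
abbrev hatObj (V : SimplexCategory ⥤ ModuleCat k) (n : ℕ) : Type :=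
  ∀ lam : DeltaSimplex n, V.obj (lam.obj (Fin.last n))

/-- The structure map `φ_* : V̂ᵐ → V̂ⁿ`, `φ_*(f)(λ) = V(λ(φ(m) n))(f(λ ∘ φ))`. -/
def hatMap (V : SimplexCategory ⥤ ModuleCat k) {m n : ℕ}
    (φ : SimplexCategory.mk m ⟶ SimplexCategory.mk n) (f : hatObj V m) : hatObj V n :=
  fun lam =>
    V.map (lam.map (homOfLE (Fin.le_last (φ.toOrderHom (Fin.last m)))))
      (f (DeltaSimplex.reindex φ lam))

/-- The map `ιⁿ : Vⁿ → V̂ⁿ`, `ι(v)(λ) = V(Υ(λ))(v)`. -/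
def iota (V : SimplexCategory ⥤ ModuleCat k) (n : ℕ) (v : V.obj (SimplexCategory.mk n)) :
    hatObj V n :=
  fun lam => V.map (upsilonHom lam) v

/-- The differential `∂ⁿ = Σᵢ (−1)ⁱ V(∂ᵢⁿ) : Cⁿ(V) → Cⁿ⁺¹(V)` of the cochain complex of a
cosimplicial vector space. -/
noncomputable def cosimplicialDiff (V : SimplexCategory ⥤ ModuleCat k) (n : ℕ)
    (v : V.obj (SimplexCategory.mk n)) : V.obj (SimplexCategory.mk (n + 1)) :=
  ∑ i : Fin (n + 2), ((-1 : k) ^ (i : ℕ)) • V.map (SimplexCategory.δ i) v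

/-- The differential of the cochain complex `C•(V̂)`. -/
noncomputable def hatDiff (V : SimplexCategory ⥤ ModuleCat k) (n : ℕ) (f : hatObj V n) :
    hatObj V (n + 1) :=
  ∑ i : Fin (n + 2), ((-1 : k) ^ (i : ℕ)) • hatMap V (SimplexCategory.δ i) f

theorem upsilonHom_naturality {m n : ℕ} (φ : SimplexCategory.mk m ⟶ SimplexCategory.mk n)
    (lam : DeltaSimplex n) :
    φ ≫ upsilonHom lam =
      upsilonHom (DeltaSimplex.reindex φ lam) ≫
        lam.map (homOfLE (Fin.le_last (φ.toOrderHom (Fin.last m)))) := by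
  apply SimplexCategory.Hom.ext
  ext i : 2
  have e : lam.map (homOfLE (Fin.le_last (φ.toOrderHom i))) =
      lam.map (homOfLE (φ.toOrderHom.monotone (Fin.le_last i))) ≫
        lam.map (homOfLE (Fin.le_last (φ.toOrderHom (Fin.last m)))) := by
    rw [← lam.map_comp]
    exact congrArg lam.map (Subsingleton.elim _ _)
  change (lam.map (homOfLE (Fin.le_last (φ.toOrderHom i)))).toOrderHom (Fin.last _) = _
  rw [e]
  rfl

theorem hatMap_iota (V : SimplexCategory ⥤ ModuleCat k) {m n : ℕ}
    (φ : SimplexCategory.mk m ⟶ SimplexCategory.mk n) (v : V.obj (SimplexCategory.mk m)) :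
    hatMap V φ (iota V m v) = iota V n (V.map φ v) := by
  funext lam
  have map_comp_apply {a b c : SimplexCategory} (f : a ⟶ b) (g : b ⟶ c) (x : V.obj a) :
      V.map (f ≫ g) x = V.map g (V.map f x) := by
    rw [V.map_comp, ModuleCat.comp_apply]
  exact (map_comp_apply _ _ v).symm.trans
    ((congrArg (fun f => V.map f v) (upsilonHom_naturality φ lam).symm).trans
      (map_comp_apply φ (upsilonHom lam) v))

theorem hatDiff_iota (V : SimplexCategory ⥤ ModuleCat k) (n : ℕ)
    (v : V.obj (SimplexCategory.mk n)) :
    hatDiff V n (iota V n v) = iota V (n + 1) (cosimplicialDiff V n v) := by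
  funext lam
  simp only [hatDiff, cosimplicialDiff, hatMap_iota, iota, Finset.sum_apply, Pi.smul_apply,
    map_sum, map_smul]

/-- `Υ(λ) : k ↦ λ(k n)(λ_k)` is order-preserving; it satisfies
`Υ(λ) ∘ φ = λ(φ(m) n) ∘ Υ(λ∘φ)`; consequently `ι : V → V̂`, `ι(v)(λ) = V(Υ(λ))(v)`, is a
morphism of cosimplicial vector spaces and induces a morphism of cochain complexes. -/
theorem upsilon_monotone_natural_and_iota_cosimplicial (V : SimplexCategory ⥤ ModuleCat k) :
    (∀ (n : ℕ) (lam : DeltaSimplex n), Monotone (upsilonFun lam)) ∧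
    (∀ (m n : ℕ) (φ : SimplexCategory.mk m ⟶ SimplexCategory.mk n) (lam : DeltaSimplex n),
      φ ≫ upsilonHom lam =
        upsilonHom (DeltaSimplex.reindex φ lam) ≫
          lam.map (homOfLE (Fin.le_last (φ.toOrderHom (Fin.last m))))) ∧
    (∀ (m n : ℕ) (φ : SimplexCategory.mk m ⟶ SimplexCategory.mk n)
      (v : V.obj (SimplexCategory.mk m)),
      hatMap V φ (iota V m v) = iota V n (V.map φ v)) ∧
    (∀ (n : ℕ) (v : V.obj (SimplexCategory.mk n)),
      hatDiff V n (iota V n v) = iota V (n + 1) (cosimplicialDiff V n v)) := by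
  exact ⟨fun _ lam => (upsilonHom lam).toOrderHom.monotone,
    fun _ _ => upsilonHom_naturality, fun _ _ => hatMap_iota V, hatDiff_iota V⟩
end

section
/- Let k be a field and V a cosimplicial k-vector space. The maps πⁿ : Cⁿ(V̂) → Cⁿ(V) defined by π(f) = (−1)^{n(n+1)/2} Σ_{0 ≤ i_k ≤ k+1} (−1)^{i_0+⋯+i_{n−1}} f(∂_{i_0}⁰ * ∂_{i_1}¹ * ⋯ * ∂_{i_{n−1}}^{n−1}) for n > 0, and by taking the component at the constant 0-simplex [0] for n = 0, form a morphism of cochain complexes π : C•(V̂) → C•(V), i.e., ∂ⁿ ∘ πⁿ = π^{n+1} ∘ ∂ⁿ for all n ≥ 0. -/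
open CategoryTheory

variable {k : Type} [Field k]

/-- The `n`-simplex `∂_{i_0}⁰ * ∂_{i_1}¹ * ⋯ * ∂_{i_{n−1}}^{n−1}` of `Δ`: the concatenation
of the coface maps `∂_{i_j}^j : [j] → [j+1]` regarded as `1`-simplices; its objects are
`[0], [1], …, [n]` and its successive maps are the coface maps. -/
noncomputable def cofaceSimplex {n : ℕ} (I : ∀ j : Fin n, Fin (j.1 + 2)) : DeltaSimplex n :=
  ComposableArrows.mkOfObjOfMapSucc (fun i => SimplexCategory.mk i.1)
    (fun i => SimplexCategory.δ (I i))

/-- The map `πⁿ : Cⁿ(V̂) → Cⁿ(V)`: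
`π(f) = (−1)^{n(n+1)/2} Σ_{0 ≤ i_k ≤ k+1} (−1)^{i_0+⋯+i_{n−1}} f(∂_{i_0}⁰ * ⋯ * ∂_{i_{n−1}}^{n−1})`
for `n > 0`, and the component of `f` at the constant `0`-simplex `[0]` for `n = 0`. -/
noncomputable def piMap (V : SimplexCategory ⥤ ModuleCat k) :
    ∀ n : ℕ, hatObj V n → V.obj (SimplexCategory.mk n)
  | 0 => fun f => f ((Functor.const (Fin 1)).obj (SimplexCategory.mk 0))
  | n + 1 => fun f =>
      ((-1 : k) ^ ((n + 1) * (n + 2) / 2)) •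
        ∑ I : ∀ j : Fin (n + 1), Fin (j.1 + 2),
          ((-1 : k) ^ (∑ j, ((I j) : ℕ))) • f (cofaceSimplex I)

/-- The map from position `x` to position `y` in `cofaceSimplex I`. -/
noncomputable def cofaceMap {n : ℕ} (I : ∀ j : Fin n, Fin (j.1 + 2)) (x y : ℕ)
    (hxy : x ≤ y) (hy : y ≤ n) : SimplexCategory.mk x ⟶ SimplexCategory.mk y :=
  (cofaceSimplex I).map' x y hxy hy

section cofaceMap

variable {n : ℕ} (I I' : ∀ j : Fin n, Fin (j.1 + 2))

lemma cofaceMap_self (x : ℕ) (hx : x ≤ n) : cofaceMap I x x le_rfl hx = 𝟙 _ :=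
  (cofaceSimplex I).map'_self x hx

lemma cofaceMap_comp (x y z : ℕ) (hxy : x ≤ y) (hyz : y ≤ z) (hz : z ≤ n) :
    cofaceMap I x z (hxy.trans hyz) hz =
      cofaceMap I x y hxy (hyz.trans hz) ≫ cofaceMap I y z hyz hz :=
  (cofaceSimplex I).map'_comp x y z hxy hyz hz

lemma cofaceMap_succ (x : ℕ) (hx : x < n) :
    cofaceMap I x (x + 1) x.le_succ hx = SimplexCategory.δ (I ⟨x, hx⟩) :=
  ComposableArrows.mkOfObjOfMapSucc_map_succ _ _ x hx

variable {I I'}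

/-- `cofaceMap I x y` depends only on the entries of `I` with indices in `[x, y)`. -/
lemma cofaceMap_congr (x y : ℕ) (hxy : x ≤ y) (hy : y ≤ n)
    (h : ∀ j : Fin n, x ≤ j.1 → j.1 < y → I j = I' j) :
    cofaceMap I x y hxy hy = cofaceMap I' x y hxy hy := by
  induction y, hxy using Nat.le_induction with
  | base => rw [cofaceMap_self, cofaceMap_self]
  | succ y hxy ih =>
    rw [cofaceMap_comp I x y _ hxy y.le_succ, cofaceMap_comp I' x y _ hxy y.le_succ,
      ih (by omega) fun j h₁ h₂ => h j h₁ (by omega), cofaceMap_succ, cofaceMap_succ,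
      h ⟨y, hy⟩ hxy (by simp)]

/-- If `I` and `I'` differ only at the two indices adjacent to the vertex `p + 1` and the
corresponding composites of cofaces agree, then the two simplices agree away from that vertex. -/
lemma cofaceMap_congr_of_comp (p : ℕ) (hp : p + 1 < n)
    (h : ∀ j : Fin n, j.1 ≠ p → j.1 ≠ p + 1 → I j = I' j)
    (hδ : SimplexCategory.δ (I ⟨p, by omega⟩) ≫ SimplexCategory.δ (I ⟨p + 1, hp⟩) =
      SimplexCategory.δ (I' ⟨p, by omega⟩) ≫ SimplexCategory.δ (I' ⟨p + 1, hp⟩))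
    (x y : ℕ) (hxy : x ≤ y) (hy : y ≤ n) (hx' : x ≠ p + 1) (hy' : y ≠ p + 1) :
    cofaceMap I x y hxy hy = cofaceMap I' x y hxy hy := by
  by_cases hc : x < p + 1 ∧ p + 1 < y
  · have hmid : cofaceMap I p (p + 2) (by omega) hp = cofaceMap I' p (p + 2) (by omega) hp := by
      rw [cofaceMap_comp I p (p + 1) (p + 2) (by omega) (by omega),
        cofaceMap_comp I' p (p + 1) (p + 2) (by omega) (by omega),
        cofaceMap_succ, cofaceMap_succ, cofaceMap_succ, cofaceMap_succ, hδ]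
    rw [cofaceMap_comp I x p y (by omega) (by omega), cofaceMap_comp I' x p y (by omega) (by omega),
      cofaceMap_comp I p (p + 2) y (by omega) (by omega),
      cofaceMap_comp I' p (p + 2) y (by omega) (by omega), hmid,
      cofaceMap_congr x p _ _ fun j _ _ => h j (by omega) (by omega),
      cofaceMap_congr (p + 2) y _ _ fun j _ _ => h j (by omega) (by omega)]
  · exact cofaceMap_congr x y hxy hy fun j _ _ => h j (by omega) (by omega)

end cofaceMap

lemma map_eval_congr (V : SimplexCategory ⥤ ModuleCat k) {n : ℕ} (f : hatObj V n)
    {lam lam' : DeltaSimplex n} (h : lam = lam') {X : SimplexCategory}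
    (g : lam.obj (Fin.last n) ⟶ X) (g' : lam'.obj (Fin.last n) ⟶ X)
    (hg : g = eqToHom (by rw [h]) ≫ g') : V.map g (f lam) = V.map g' (f lam') := by
  subst h hg
  simp

/-- The value of `f` at `cofaceSimplex I`. -/
noncomputable def cofaceEval (V : SimplexCategory ⥤ ModuleCat k) {n : ℕ} (f : hatObj V n)
    (I : ∀ j : Fin n, Fin (j.1 + 2)) : V.obj (SimplexCategory.mk n) :=
  f (cofaceSimplex I)

lemma hatMap_δ_congr (V : SimplexCategory ⥤ ModuleCat k) {n : ℕ} (f : hatObj V n)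
    (I I' : ∀ j : Fin (n + 1), Fin (j.1 + 2)) (i : Fin (n + 1))
    (h : ∀ (x y : ℕ) (hxy : x ≤ y) (hy : y ≤ n + 1), x ≠ i → y ≠ i →
      cofaceMap I x y hxy hy = cofaceMap I' x y hxy hy) :
    cofaceEval V (hatMap V (SimplexCategory.δ i.castSucc) f) I =
      cofaceEval V (hatMap V (SimplexCategory.δ i.castSucc) f) I' := by
  let φ := SimplexCategory.δ (n := n) i.castSucc
  have hne (a : Fin (n + 1)) : (i.castSucc.succAbove a).1 ≠ i.1 := fun e =>
    Fin.succAbove_ne i.castSucc a (Fin.ext e)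
  refine map_eval_congr V f (lam := DeltaSimplex.reindex φ (cofaceSimplex I))
    (lam' := DeltaSimplex.reindex φ (cofaceSimplex I'))
    (ComposableArrows.ext (fun _ => rfl) fun a ha => ?_)
    ((cofaceSimplex I).map (homOfLE (Fin.le_last (φ.toOrderHom (Fin.last n)))))
    ((cofaceSimplex I').map (homOfLE (Fin.le_last (φ.toOrderHom (Fin.last n))))) ?_
  · refine (h _ _ (?_ : (i.castSucc.succAbove ⟨a, by omega⟩).1 ≤
      (i.castSucc.succAbove ⟨a + 1, by omega⟩).1) (Fin.is_le _) (hne _) (hne _)).trans ?_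
    · exact (Fin.succAbove_le_succAbove_iff).2 (by simp)
    · exact ((Category.id_comp _).trans (Category.comp_id _)).symm
  · refine (h _ _ (Fin.le_last (i.castSucc.succAbove (Fin.last n))) le_rfl (hne _) ?_).trans
      (Category.id_comp _).symm
    exact fun e => by have := i.2; simp at e; omega

lemma δ_last_eq (n : ℕ) : SimplexCategory.δ (Fin.last (n + 1)) =
    SimplexCategory.Hom.mk (Fin.castSuccOrderEmb (n := n + 1)).toOrderHom := by
  ext a
  simp [SimplexCategory.δ]

lemma hatMap_δ_last (V : SimplexCategory ⥤ ModuleCat k) {n : ℕ} (f : hatObj V n)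
    (I : ∀ j : Fin (n + 1), Fin (j.1 + 2)) :
    cofaceEval V (hatMap V (SimplexCategory.δ (Fin.last (n + 1))) f) I =
      V.map (SimplexCategory.δ (I (Fin.last n)))
        (cofaceEval V f fun j : Fin n => I j.castSucc) := by
  rw [δ_last_eq]
  let φ := SimplexCategory.Hom.mk (Fin.castSuccOrderEmb (n := n + 1)).toOrderHom
  refine map_eval_congr V f (lam := DeltaSimplex.reindex φ (cofaceSimplex I))
    (lam' := cofaceSimplex fun j : Fin n => I j.castSucc)
    (ComposableArrows.ext (fun _ => rfl) fun a ha => ?_)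
    ((cofaceSimplex I).map (homOfLE (Fin.le_last (φ.toOrderHom (Fin.last n)))))
    (SimplexCategory.δ (I (Fin.last n))) ?_
  · refine Eq.trans (?_ : _ = cofaceMap (fun j : Fin n => I j.castSucc) a (a + 1) a.le_succ ha)
      ((Category.id_comp _).trans (Category.comp_id _)).symm
    exact (cofaceMap_succ I a (by omega)).trans
      (cofaceMap_succ (fun j : Fin n => I j.castSucc) a ha).symm
  · exact (cofaceMap_succ I n (by omega)).trans (Category.id_comp _).symm

/-- Exchange of two adjacent coface indices along the cosimplicial identity
`∂_b ∘ ∂_a = ∂_a ∘ ∂_{b-1}` for `a < b`. -/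
def cofaceSwap {m : ℕ} (q : Fin (m + 2) × Fin (m + 3)) : Fin (m + 2) × Fin (m + 3) :=
  if h : q.1.1 < q.2.1 then (⟨q.2.1 - 1, by omega⟩, q.1.castSucc)
  else (⟨q.2.1, by omega⟩, q.1.succ)

section cofaceSwap

variable {m : ℕ} (q : Fin (m + 2) × Fin (m + 3))

lemma cofaceSwap_cofaceSwap : cofaceSwap (cofaceSwap q) = q := by
  obtain ⟨⟨a, ha⟩, ⟨b, hb⟩⟩ := q
  by_cases h : a < b
  · have h' : ¬ b - 1 < a := by omega
    simp [cofaceSwap, h, h']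
    omega
  · have h' : b < a + 1 := by omega
    simp [cofaceSwap, h, h']

lemma neg_one_pow_cofaceSwap :
    (-1 : k) ^ ((cofaceSwap q).1.1 + (cofaceSwap q).2.1) = -(-1) ^ (q.1.1 + q.2.1) := by
  obtain ⟨⟨a, ha⟩, ⟨b, hb⟩⟩ := q
  by_cases h : a < b
  · simp only [cofaceSwap, h, dite_true]
    obtain ⟨c, rfl⟩ := Nat.exists_eq_add_of_lt h
    simp
    ring
  · simp [cofaceSwap, h]
    ring

lemma δ_comp_δ_cofaceSwap :
    SimplexCategory.δ (cofaceSwap q).1 ≫ SimplexCategory.δ (cofaceSwap q).2 =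
      SimplexCategory.δ q.1 ≫ SimplexCategory.δ q.2 := by
  obtain ⟨a, b⟩ := q
  unfold cofaceSwap
  split_ifs with h
  · exact (SimplexCategory.δ_comp_δ' h).symm
  · exact SimplexCategory.δ_comp_δ'' (i := b) (j := a) (not_lt.1 h)

end cofaceSwap

lemma sum_smul_eq_zero_of_involution {ι M : Type*} [Fintype ι] [AddCommGroup M] [Module k M]
    (s : ι → k) (v : ι → M) (g : ι → ι) (hg : ∀ a, g (g a) = a) (hne : ∀ a, g a ≠ a)
    (hs : ∀ a, s (g a) = -s a) (hv : ∀ a, v (g a) = v a) : ∑ a, s a • v a = 0 :=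
  Finset.sum_ninvolution g (fun a => by rw [hs, hv, neg_smul, add_neg_cancel])
    (fun a _ => hne a) (fun _ => Finset.mem_univ _) hg

/-- Exchange of the entries of `I` at the indices `p` and `p + 1`. -/
def multiSwap {n : ℕ} (p : Fin n) (I : ∀ j : Fin (n + 1), Fin (j.1 + 2)) :
    ∀ j : Fin (n + 1), Fin (j.1 + 2) :=
  Function.update
    (Function.update I p.castSucc (cofaceSwap (m := p) (I p.castSucc, I p.succ)).1)
    p.succ (cofaceSwap (m := p) (I p.castSucc, I p.succ)).2

section multiSwap

variable {n : ℕ} (p : Fin n) (I : ∀ j : Fin (n + 1), Fin (j.1 + 2))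

lemma multiSwap_castSucc :
    multiSwap p I p.castSucc = (cofaceSwap (m := p) (I p.castSucc, I p.succ)).1 := by
  rw [multiSwap, Function.update_of_ne p.castSucc_lt_succ.ne, Function.update_self]

lemma multiSwap_succ :
    multiSwap p I p.succ = (cofaceSwap (m := p) (I p.castSucc, I p.succ)).2 := by
  rw [multiSwap, Function.update_self]

lemma multiSwap_of_ne {j : Fin (n + 1)} (h₁ : j ≠ p.castSucc) (h₂ : j ≠ p.succ) :
    multiSwap p I j = I j := by
  rw [multiSwap, Function.update_of_ne h₂, Function.update_of_ne h₁]

lemma multiSwap_multiSwap : multiSwap p (multiSwap p I) = I := by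
  have h := cofaceSwap_cofaceSwap (m := p) (I p.castSucc, I p.succ)
  funext j
  by_cases h₁ : j = p.castSucc
  · subst h₁
    rw [multiSwap_castSucc, multiSwap_castSucc, multiSwap_succ]
    exact congrArg Prod.fst h
  by_cases h₂ : j = p.succ
  · subst h₂
    rw [multiSwap_succ, multiSwap_castSucc, multiSwap_succ]
    exact congrArg Prod.snd h
  rw [multiSwap_of_ne p _ h₁ h₂, multiSwap_of_ne p _ h₁ h₂]

lemma neg_one_pow_sum_multiSwap :
    (-1 : k) ^ (∑ j, (multiSwap p I j).1) = -(-1) ^ (∑ j, (I j).1) := by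
  have hsplit (J : ∀ j : Fin (n + 1), Fin (j.1 + 2)) : ∑ j, (J j).1 =
      ((J p.castSucc).1 + (J p.succ).1) + ∑ j ∈ {p.castSucc, p.succ}ᶜ, (J j).1 := by
    rw [← Finset.sum_pair (f := fun j => (J j).1) p.castSucc_lt_succ.ne,
      Finset.sum_add_sum_compl]
  have hrest : ∑ j ∈ {p.castSucc, p.succ}ᶜ, (multiSwap p I j).1 =
      ∑ j ∈ {p.castSucc, p.succ}ᶜ, (I j).1 :=
    Finset.sum_congr rfl fun j hj => by
      simp only [Finset.mem_compl, Finset.mem_insert, Finset.mem_singleton, not_or] at hj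
      rw [multiSwap_of_ne p I hj.1 hj.2]
  have h := neg_one_pow_cofaceSwap (k := k) (m := p) (I p.castSucc, I p.succ)
  rw [hsplit, hsplit I, hrest, pow_add, pow_add _ (_ + _), multiSwap_castSucc, multiSwap_succ,
    ← neg_mul]
  exact congrArg (· * _) h

lemma hatMap_multiSwap (V : SimplexCategory ⥤ ModuleCat k) (f : hatObj V n) :
    cofaceEval V (hatMap V (SimplexCategory.δ p.succ.castSucc) f) (multiSwap p I) =
      cofaceEval V (hatMap V (SimplexCategory.δ p.succ.castSucc) f) I := by
  refine hatMap_δ_congr V f _ _ _ fun x y hxy hy hx' hy' =>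
    cofaceMap_congr_of_comp p (by omega) (fun j h₁ h₂ =>
      multiSwap_of_ne p I (fun e => h₁ (congrArg Fin.val e)) fun e => h₂ (congrArg Fin.val e))
      ?_ x y hxy hy hx' hy'
  have h₁ := multiSwap_castSucc p I
  have h₂ := multiSwap_succ p I
  refine Eq.trans ?_ (δ_comp_δ_cofaceSwap (m := p) (I p.castSucc, I p.succ))
  rw [← h₁, ← h₂]
  rfl

end multiSwap

/-- Exchange of the two possible values of the entry of `I` at the index `0`. -/
def flipZero {n : ℕ} (I : ∀ j : Fin (n + 1), Fin (j.1 + 2)) : ∀ j : Fin (n + 1), Fin (j.1 + 2) :=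
  Function.update I 0 (Fin.rev (I 0))

section flipZero

variable {n : ℕ} (I : ∀ j : Fin (n + 1), Fin (j.1 + 2))

lemma flipZero_zero : flipZero I 0 = Fin.rev (I 0) := by
  rw [flipZero, Function.update_self]

lemma flipZero_of_ne {j : Fin (n + 1)} (h : j ≠ 0) : flipZero I j = I j := by
  rw [flipZero, Function.update_of_ne h]

lemma flipZero_zero_add : (flipZero I 0).1 + (I 0).1 = 1 := by
  have h : (I 0).1 < 2 := (I 0).2
  have h' : (flipZero I 0).1 = 2 - ((I 0).1 + 1) := by
    rw [flipZero_zero]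
    exact Fin.val_rev _
  omega

lemma flipZero_flipZero : flipZero (flipZero I) = I := by
  funext j
  by_cases h : j = 0
  · subst h
    rw [flipZero_zero, flipZero_zero]
    exact Fin.rev_rev _
  · rw [flipZero_of_ne _ h, flipZero_of_ne _ h]

lemma flipZero_ne : flipZero I ≠ I := fun h => by
  have := flipZero_zero_add I
  rw [h] at this
  omega

lemma neg_one_pow_sum_flipZero :
    (-1 : k) ^ (∑ j, (flipZero I j).1) = -(-1) ^ (∑ j, (I j).1) := by
  have hrest : ∑ j : Fin n, (flipZero I j.succ).1 = ∑ j : Fin n, (I j.succ).1 :=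
    Finset.sum_congr rfl fun j _ => by rw [flipZero_of_ne I j.succ_ne_zero]
  have h := flipZero_zero_add I
  rw [Fin.sum_univ_succ, Fin.sum_univ_succ (fun j => (I j).1), hrest, pow_add, pow_add, ← neg_mul]
  congr 1
  obtain ⟨h₁, h₂⟩ | ⟨h₁, h₂⟩ := Nat.add_eq_one_iff.1 h <;> simp [h₁, h₂]

end flipZero

/-- The contributions of the cofaces of `V̂` other than the last one cancel. -/
lemma sum_hatMap_castSucc_eq_zero (V : SimplexCategory ⥤ ModuleCat k) {n : ℕ} (f : hatObj V n)
    (i : Fin (n + 1)) :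
    ∑ I : ∀ j : Fin (n + 1), Fin (j.1 + 2), ((-1 : k) ^ (∑ j, (I j).1)) •
      cofaceEval V (hatMap V (SimplexCategory.δ i.castSucc) f) I = 0 := by
  rcases Fin.eq_zero_or_eq_succ i with rfl | ⟨p, rfl⟩
  · refine sum_smul_eq_zero_of_involution _ _ flipZero flipZero_flipZero flipZero_ne
      neg_one_pow_sum_flipZero fun I => hatMap_δ_congr V f _ _ _ fun x y hxy hy hx' _ =>
        cofaceMap_congr x y hxy hy fun j hj _ => flipZero_of_ne I fun e => hx' ?_
    subst e
    simpa using hj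
  · exact sum_smul_eq_zero_of_involution _ _ (multiSwap p) (multiSwap_multiSwap p)
      (fun I h => by
        have := neg_one_pow_sum_multiSwap (k := ℚ) p I
        rw [h, self_eq_neg] at this
        simp at this)
      (neg_one_pow_sum_multiSwap p) fun I => hatMap_multiSwap p I V f

lemma piMap_eq (V : SimplexCategory ⥤ ModuleCat k) (n : ℕ) (f : hatObj V n) :
    piMap V n f = ((-1 : k) ^ (n * (n + 1) / 2)) •
      ∑ I : ∀ j : Fin n, Fin (j.1 + 2), ((-1 : k) ^ (∑ j, (I j).1)) •
        cofaceEval V f I := by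
  cases n with
  | succ n => rfl
  | zero =>
    have h (I : ∀ j : Fin 0, Fin (j.1 + 2)) :
        cofaceEval V f I = piMap V 0 f :=
      eq_of_heq (congr_arg_heq f (ComposableArrows.ext₀ rfl))
    simp [h]

lemma sum_hatDiff (V : SimplexCategory ⥤ ModuleCat k) (n : ℕ) (f : hatObj V n) :
    ∑ I : ∀ j : Fin (n + 1), Fin (j.1 + 2), ((-1 : k) ^ (∑ j, (I j).1)) •
        cofaceEval V (hatDiff V n f) I =
      (-1 : k) ^ (n + 1) • ∑ I : ∀ j : Fin (n + 1), Fin (j.1 + 2),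
        ((-1 : k) ^ (∑ j, (I j).1)) • V.map (SimplexCategory.δ (I (Fin.last n)))
          (cofaceEval V f fun j : Fin n => I j.castSucc) := by
  have hdiff (I : ∀ j : Fin (n + 1), Fin (j.1 + 2)) : cofaceEval V (hatDiff V n f) I =
      ∑ i : Fin (n + 2), ((-1 : k) ^ (i : ℕ)) • cofaceEval V (hatMap V (SimplexCategory.δ i) f) I :=
    Finset.sum_apply (cofaceSimplex I) Finset.univ fun i : Fin (n + 2) =>
      ((-1 : k) ^ (i : ℕ)) • hatMap V (SimplexCategory.δ i) f
  calc
    _ = ∑ i : Fin (n + 2), ((-1 : k) ^ (i : ℕ)) • ∑ I : ∀ j : Fin (n + 1), Fin (j.1 + 2),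
        ((-1 : k) ^ (∑ j, (I j).1)) • cofaceEval V (hatMap V (SimplexCategory.δ i) f) I := by
      simp only [hdiff, Finset.smul_sum]
      rw [Finset.sum_comm]
      exact Finset.sum_congr rfl fun i _ => Finset.sum_congr rfl fun I _ => smul_comm _ _ _
    _ = _ := by
      rw [Fin.sum_univ_castSucc]
      simp only [sum_hatMap_castSucc_eq_zero, smul_zero, Finset.sum_const_zero, zero_add,
        hatMap_δ_last, Fin.val_last]

lemma cosimplicialDiff_sum (V : SimplexCategory ⥤ ModuleCat k) (n : ℕ) (f : hatObj V n) :
    cosimplicialDiff V n (∑ I : ∀ j : Fin n, Fin (j.1 + 2),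
        ((-1 : k) ^ (∑ j, (I j).1)) • cofaceEval V f I) =
      ∑ I : ∀ j : Fin (n + 1), Fin (j.1 + 2),
        ((-1 : k) ^ (∑ j, (I j).1)) • V.map (SimplexCategory.δ (I (Fin.last n)))
          (cofaceEval V f fun j : Fin n => I j.castSucc) := by
  rw [← (Fin.snocEquiv fun j : Fin (n + 1) => Fin (j.1 + 2)).sum_comp, Fintype.sum_prod_type]
  refine Finset.sum_congr rfl fun a _ => ?_
  rw [map_sum, Finset.smul_sum]
  refine Finset.sum_congr rfl fun I _ => ?_
  rw [map_smul, smul_smul, ← pow_add]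
  simp only [Fin.snocEquiv, Equiv.coe_fn_mk, Fin.sum_univ_castSucc, Fin.snoc_castSucc,
    Fin.snoc_last]
  rw [add_comm a.1]

/-- `π : C•(V̂) → C•(V)` is a morphism of cochain complexes:
`∂ⁿ ∘ πⁿ = πⁿ⁺¹ ∘ ∂ⁿ` for all `n ≥ 0`. -/
theorem piMap_is_chain_map (V : SimplexCategory ⥤ ModuleCat k) (n : ℕ) (f : hatObj V n) :
    cosimplicialDiff V n (piMap V n f) = piMap V (n + 1) (hatDiff V n f) := by
  have hsmul (c : k) (v : V.obj (SimplexCategory.mk n)) :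
      cosimplicialDiff V n (c • v) = c • cosimplicialDiff V n v := by
    simp only [cosimplicialDiff, map_smul, Finset.smul_sum]
    exact Finset.sum_congr rfl fun i _ => smul_comm _ _ _
  have hsign : (n + 1) * (n + 1 + 1) / 2 = n * (n + 1) / 2 + (n + 1) := by
    rw [← Nat.add_mul_div_right _ _ two_pos]
    ring_nf
  rw [piMap_eq, piMap_eq, sum_hatDiff, hsmul, cosimplicialDiff_sum, smul_smul, ← pow_add, hsign,
    add_assoc, pow_add, Even.neg_one_pow (Even.add_self (n + 1)), mul_one]
end

section
/- Let k be a field and V a cosimplicial k-vector space. The composite π∘ι : C•(V) → C•(V) preserves the normalized subcomplex C̄•(V) and restricts to the identity on it: for every n and every v ∈ Vⁿ with V(sᵢⁿ)(v) = 0 for all 0 ≤ i ≤ n−1, one has π(ι(v)) = v. Consequently π∘ι induces the identity map on the cohomology of C•(V). -/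
open CategoryTheory

variable {k : Type} [Field k]

/-- The underlying map of `Υ(∂_{i_0}⁰ * ⋯ * ∂_{i_{n−1}}^{n−1})`, defined by recursion on `n`. -/
def iterFace : ∀ n : ℕ, (∀ j : Fin n, Fin (j.1 + 2)) → Fin (n + 1) → Fin (n + 1)
  | 0, _ => id
  | n + 1, I =>
      Fin.snoc (α := fun _ => Fin (n + 2))
        (fun k => Fin.succAbove (n := n + 1) (I (Fin.last n))
          (iterFace n (fun j => I j.castSucc) k))
        (Fin.last (n + 1))

lemma iterFace_castSucc {n : ℕ} (I : ∀ j : Fin (n + 1), Fin (j.1 + 2)) (a : Fin (n + 1)) :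
    iterFace (n + 1) I a.castSucc =
      Fin.succAbove (n := n + 1) (I (Fin.last n)) (iterFace n (fun j => I j.castSucc) a) := by
  rw [iterFace, Fin.snoc_castSucc]

lemma iterFace_last (n : ℕ) (I : ∀ j : Fin n, Fin (j.1 + 2)) :
    iterFace n I (Fin.last n) = Fin.last n := by
  cases n with
  | zero => rfl
  | succ n => rw [iterFace, Fin.snoc_last]

lemma iterFace_top (n : ℕ) : iterFace n (fun j => Fin.last (j.1 + 1)) = id := by
  induction n with
  | zero => rfl
  | succ n ih =>
    funext a
    induction a using Fin.lastCases with
    | last => rw [iterFace_last]; rfl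
    | cast a =>
      rw [iterFace_castSucc]
      have := congrFun ih a
      simp only [Fin.val_castSucc, Fin.val_last, id_eq] at this ⊢
      rw [this, Fin.succAbove_last]

lemma eq_top_of_iterFace_eq_id (n : ℕ) (I : ∀ j : Fin n, Fin (j.1 + 2))
    (h : iterFace n I = id) (j : Fin n) : I j = Fin.last (j.1 + 1) := by
  induction n with
  | zero => exact j.elim0
  | succ n ih =>
    have hlast : I (Fin.last n) = Fin.last (n + 1) := by
      have h1 := congrFun h (Fin.last n).castSucc
      rw [iterFace_castSucc, iterFace_last] at h1
      by_contra hne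
      have hlt : (I (Fin.last n)).val < n + 1 := by
        have := (I (Fin.last n)).isLt
        have h3 : (I (Fin.last n)).val ≠ n + 1 := fun e => hne (Fin.ext e)
        simp only [Fin.val_last] at this
        omega
      rw [Fin.succAbove_of_le_castSucc] at h1
      · simpa using congrArg Fin.val h1
      · exact Fin.le_def.mpr (Nat.lt_succ_iff.mp hlt)
    induction j using Fin.lastCases with
    | last => exact hlast
    | cast j =>
      refine ih (fun j => I j.castSucc) ?_ j
      funext a
      have h1 := congrFun h a.castSucc
      rw [iterFace_castSucc, hlast, Fin.succAbove_last] at h1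
      exact Fin.castSucc_injective _ h1

lemma cofaceSimplex_map_castSucc {n : ℕ} (I : ∀ j : Fin (n + 1), Fin (j.1 + 2))
    (a b : Fin (n + 1)) (hab : a ≤ b) :
    (cofaceSimplex I).map (homOfLE (Fin.castSucc_le_castSucc_iff.mpr hab)) =
      (cofaceSimplex (fun j : Fin n => I j.castSucc)).map (homOfLE hab) := by
  obtain ⟨a, ha⟩ := a
  obtain ⟨b, hb⟩ := b
  obtain ⟨d, rfl⟩ := Nat.exists_eq_add_of_le (show a ≤ b from hab)
  induction d with
  | zero =>
    exact ((cofaceSimplex I).map_id (Fin.castSucc ⟨a, ha⟩)).trans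
      ((cofaceSimplex (fun j : Fin n => I j.castSucc)).map_id ⟨a, ha⟩).symm
  | succ d ih =>
    have key : ∀ {m : ℕ} (J : ∀ j : Fin m, Fin (j.1 + 2)) (h0 : a < m + 1) (h1 : a + (d + 1) < m + 1)
        (hle : (⟨a, h0⟩ : Fin (m + 1)) ≤ ⟨a + (d + 1), h1⟩),
        (cofaceSimplex J).map (homOfLE hle) =
          (cofaceSimplex J).map (homOfLE (show (⟨a, h0⟩ : Fin (m + 1)) ≤ ⟨a + d, by omega⟩ from
            Fin.le_def.mpr (Nat.le_add_right _ _))) ≫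
            SimplexCategory.δ (J ⟨a + d, by omega⟩) := by
      intro m J h0 h1 hle
      have e := ComposableArrows.mkOfObjOfMapSucc_map_succ
        (fun i : Fin (m + 1) => SimplexCategory.mk i.1)
        (fun i => SimplexCategory.δ (J i)) (a + d) (by omega)
      rw [← e]
      exact (cofaceSimplex J).map_comp _ _
    rw [key (fun j : Fin n => I j.castSucc) ha hb]
    refine (key I _ _ _).trans ?_
    rw [← ih (by omega) (Fin.le_def.mpr (Nat.le_add_right _ _))]
    rfl

lemma upsilonFun_cofaceSimplex (n : ℕ) (I : ∀ j : Fin n, Fin (j.1 + 2)) (a : Fin (n + 1)) :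
    upsilonFun (cofaceSimplex I) a = iterFace n I a := by
  induction n with
  | zero => exact Subsingleton.elim (α := Fin 1) _ _
  | succ n ih =>
    induction a using Fin.lastCases with
    | last =>
      rw [iterFace_last]
      have : (cofaceSimplex I).map (homOfLE (Fin.le_last (Fin.last (n + 1)))) = 𝟙 _ :=
        (cofaceSimplex I).map_id _
      rw [upsilonFun, this]
      rfl
    | cast a =>
      rw [iterFace_castSucc, ← ih]
      have e := ComposableArrows.mkOfObjOfMapSucc_map_succ
        (fun i : Fin (n + 2) => SimplexCategory.mk i.1)
        (fun i => SimplexCategory.δ (I i)) n (by omega)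
      have e2 : (cofaceSimplex I).map (homOfLE (Fin.le_last a.castSucc)) =
          (cofaceSimplex I).map (homOfLE (Fin.castSucc_le_castSucc_iff.mpr (Fin.le_last a))) ≫
            SimplexCategory.δ (I (Fin.last n)) := by
        refine Eq.trans ?_ (congrArg (fun t => (cofaceSimplex I).map (homOfLE
          (Fin.castSucc_le_castSucc_iff.mpr (Fin.le_last a))) ≫ t) e)
        exact (cofaceSimplex I).map_comp _ _
      rw [upsilonFun, e2, cofaceSimplex_map_castSucc I a (Fin.last n) (Fin.le_last a)]
      rfl

section Cancellation

variable {M : Type*} [AddCommGroup M] [Module k M]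

lemma sum_faces_eq_zero {m : ℕ} (G : (Fin (m + 1) → Fin (m + 3)) → M) :
    ∑ p : Fin (m + 2) × Fin (m + 3),
      ((-1 : k) ^ (p.1 + p.2 : ℕ)) • G (p.2.succAbove ∘ p.1.succAbove) = 0 := by
  have hval : ∀ p : Fin (m + 2) × Fin (m + 3),
      ((p.1.predAbove p.2 : Fin (m + 2)) : ℕ) = (if (p.1 : ℕ) < p.2 then (p.2 : ℕ) - 1 else p.2) ∧
      ((p.2.succAbove p.1 : Fin (m + 3)) : ℕ) = (if (p.1 : ℕ) < p.2 then (p.1 : ℕ) else p.1 + 1) := by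
    rintro ⟨i, j⟩
    constructor
    · simp only [Fin.predAbove, Fin.lt_def, Fin.val_castSucc]
      split_ifs <;> simp
    · simp only [Fin.succAbove, Fin.lt_def, Fin.val_castSucc]
      split_ifs <;> simp
  refine Finset.sum_involution
    (fun p _ => ((p.1.predAbove p.2 : Fin (m + 2)), (p.2.succAbove p.1 : Fin (m + 3)))) ?_ ?_ ?_ ?_
  · intro p _
    have hG : (p.2.succAbove p.1).succAbove ∘ (p.1.predAbove p.2).succAbove =
        p.2.succAbove ∘ p.1.succAbove :=
      funext fun a => Fin.succAbove_succAbove_succAbove_predAbove p.2 p.1 a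
    rw [hG, ← add_smul]
    have hs : ((-1 : k) ^ (p.1 + p.2 : ℕ)) +
        (-1 : k) ^ (((p.1.predAbove p.2 : Fin (m + 2)) : ℕ) +
          ((p.2.succAbove p.1 : Fin (m + 3)) : ℕ)) = 0 := by
      rw [(hval p).1, (hval p).2]
      split_ifs with h
      · obtain ⟨c, hc⟩ := Nat.exists_eq_add_of_lt h
        rw [hc]
        simp only [Nat.add_sub_cancel]
        ring
      · ring
    rw [hs, zero_smul]
  · intro p _ _ h
    have := congrArg (fun q => (q.2 : ℕ)) h
    simp only [(hval p).2] at this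
    split_ifs at this <;> omega
  · intro p _
    exact Finset.mem_univ _
  · intro p _
    refine Prod.ext (Fin.ext ?_) (Fin.ext ?_)
    · rw [(hval _).1]
      simp only [(hval p).1, (hval p).2]
      split_ifs <;> omega
    · rw [(hval _).2]
      simp only [(hval p).1, (hval p).2]
      split_ifs <;> omega

lemma sum_snoc (n : ℕ) (f : (∀ j : Fin (n + 1), Fin (j.1 + 2)) → M) :
    ∑ I, f I = ∑ I : ∀ j : Fin n, Fin (j.1 + 2), ∑ i : Fin (n + 2),
      f (Fin.snoc (α := fun j : Fin (n + 1) => Fin (j.1 + 2)) I i) := by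
  rw [← (Fin.snocEquiv (fun j : Fin (n + 1) => Fin (j.1 + 2))).sum_comp,
    Fintype.sum_prod_type_right]
  rfl

lemma sum_val_snoc (n : ℕ) (I : ∀ j : Fin n, Fin (j.1 + 2)) (i : Fin (n + 2)) :
    ∑ j, ((Fin.snoc (α := fun j : Fin (n + 1) => Fin (j.1 + 2)) I i j : Fin (j.1 + 2)) : ℕ) =
      ∑ j, (I j : ℕ) + i := by
  rw [Fin.sum_univ_castSucc]
  simp only [Fin.snoc_castSucc, Fin.snoc_last]

lemma iterFace_snoc (n : ℕ) (I : ∀ j : Fin n, Fin (j.1 + 2)) (i : Fin (n + 2)) :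
    iterFace (n + 1) (Fin.snoc (α := fun j : Fin (n + 1) => Fin (j.1 + 2)) I i) =
      Fin.snoc (α := fun _ => Fin (n + 2)) (i.succAbove ∘ iterFace n I) (Fin.last (n + 1)) := by
  rw [iterFace]
  simp only [Fin.snoc_castSucc, Fin.snoc_last]
  rfl

lemma sum_iterFace_comp_face_eq_zero (n : ℕ) (F : (Fin (n + 1) → Fin (n + 2)) → M)
    (j : Fin (n + 1)) :
    ∑ I : ∀ j : Fin (n + 1), Fin (j.1 + 2),
      ((-1 : k) ^ (∑ j, (I j : ℕ))) • F (iterFace (n + 1) I ∘ j.castSucc.succAbove) = 0 := by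
  induction n with
  | zero =>
    rw [sum_snoc]
    refine Finset.sum_eq_zero fun I _ => ?_
    have hc : ∀ i : Fin 2, iterFace 1 (Fin.snoc (α := fun j : Fin 1 => Fin (j.1 + 2)) I i) ∘
        j.castSucc.succAbove = fun _ => Fin.last 1 := by
      intro i
      funext a
      have : j.castSucc.succAbove a = Fin.last 1 := by
        have h1 : j = 0 := Subsingleton.elim (α := Fin 1) _ _
        have h2 : a = 0 := Subsingleton.elim (α := Fin 1) _ _
        subst h1 h2; rfl
      rw [Function.comp_apply, this, iterFace_last]
    simp only [hc, sum_val_snoc]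
    rw [Fin.sum_univ_two]
    simp
  | succ n ih =>
    induction j using Fin.lastCases with
    | cast j =>
      have hc : ∀ (I : ∀ j : Fin (n + 1), Fin (j.1 + 2)) (i : Fin (n + 3)),
          iterFace (n + 2) (Fin.snoc (α := fun j : Fin (n + 2) => Fin (j.1 + 2)) I i) ∘
            j.castSucc.castSucc.succAbove =
          Fin.snoc (α := fun _ => Fin (n + 3))
            (i.succAbove ∘ (iterFace (n + 1) I ∘ j.castSucc.succAbove)) (Fin.last (n + 2)) := by
        intro I i
        rw [iterFace_snoc]
        funext a
        induction a using Fin.lastCases with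
        | last =>
          rw [Function.comp_apply, Fin.succAbove_of_le_castSucc _ _
            (Fin.castSucc_le_castSucc_iff.mpr (Fin.le_last _)), Fin.succ_last, Fin.snoc_last,
            Fin.snoc_last]
        | cast a =>
          simp only [Function.comp_apply, Fin.castSucc_succAbove_castSucc, Fin.snoc_castSucc]
      rw [sum_snoc, Finset.sum_comm]
      refine Finset.sum_eq_zero fun i _ => ?_
      simp only [hc, sum_val_snoc, pow_add, mul_comm _ ((-1 : k) ^ (i : ℕ)), mul_smul]
      rw [← Finset.smul_sum, ih (fun g => F (Fin.snoc (α := fun _ => Fin (n + 3))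
        (i.succAbove ∘ g) (Fin.last (n + 2)))) j, smul_zero]
    | last =>
      have hc : ∀ (I : ∀ j : Fin n, Fin (j.1 + 2)) (i' : Fin (n + 2)) (i : Fin (n + 3)),
          iterFace (n + 2) (Fin.snoc (α := fun j : Fin (n + 2) => Fin (j.1 + 2))
            (Fin.snoc (α := fun j : Fin (n + 1) => Fin (j.1 + 2)) I i') i) ∘
            (Fin.last (n + 1)).castSucc.succAbove =
          Fin.snoc (α := fun _ => Fin (n + 3))
            ((i.succAbove ∘ i'.succAbove) ∘ iterFace n I) (Fin.last (n + 2)) := by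
        intro I i' i
        rw [iterFace_snoc, iterFace_snoc]
        funext a
        induction a using Fin.lastCases with
        | last =>
          rw [Function.comp_apply, Fin.snoc_last, Fin.succAbove_of_le_castSucc _ _ le_rfl,
            Fin.succ_last, Fin.snoc_last]
        | cast a =>
          rw [Function.comp_apply, Fin.castSucc_succAbove_castSucc, Fin.snoc_castSucc,
            Fin.snoc_castSucc, Function.comp_apply, Fin.succAbove_last, Fin.snoc_castSucc]
          rfl
      rw [sum_snoc, sum_snoc]
      refine Finset.sum_eq_zero fun I _ => ?_
      simp only [hc, sum_val_snoc, add_assoc, pow_add _ (∑ j, (I j : ℕ)), mul_smul]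
      simp only [← Finset.smul_sum]
      rw [← Fintype.sum_prod_type', sum_faces_eq_zero (fun g => F (Fin.snoc
        (α := fun _ => Fin (n + 3)) (g ∘ iterFace n I) (Fin.last (n + 2)))), smul_zero]

end Cancellation

open Classical in
/-- `V(g)(v)` for a function `g : [m] → [n]` that preserves the order, and `0` for any other `g`. -/
noncomputable def mapFun (V : SimplexCategory ⥤ ModuleCat.{0} k) {m n : ℕ}
    (v : V.obj (SimplexCategory.mk m)) (g : Fin (m + 1) → Fin (n + 1)) :
    V.obj (SimplexCategory.mk n) :=
  if h : Monotone g then V.map (SimplexCategory.mkHom ⟨g, h⟩) v else 0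

lemma map_eq_mapFun (V : SimplexCategory ⥤ ModuleCat.{0} k) {m n : ℕ}
    (v : V.obj (SimplexCategory.mk m)) (f : SimplexCategory.mk m ⟶ SimplexCategory.mk n) :
    V.map f v = mapFun V v (fun a => f.toOrderHom a) := by
  have h : Monotone fun a => f.toOrderHom a := f.toOrderHom.monotone
  rw [mapFun, dif_pos h]
  exact congrArg (fun g => V.map g v) (SimplexCategory.Hom.ext _ _ (OrderHom.ext _ _ rfl))

lemma monotone_iterFace (n : ℕ) (I : ∀ j : Fin n, Fin (j.1 + 2)) : Monotone (iterFace n I) := by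
  have h : (fun a => (upsilonHom (cofaceSimplex I)).toOrderHom a) = iterFace n I :=
    funext fun a => upsilonFun_cofaceSimplex n I a
  rw [← h]
  exact (upsilonHom (cofaceSimplex I)).toOrderHom.monotone

lemma iota_cofaceSimplex (V : SimplexCategory ⥤ ModuleCat.{0} k) (n : ℕ)
    (v : V.obj (SimplexCategory.mk n)) (I : ∀ j : Fin n, Fin (j.1 + 2)) :
    iota V n v (cofaceSimplex I) = mapFun V v (iterFace n I) := by
  refine (map_eq_mapFun V v (n := n) (upsilonHom (cofaceSimplex I))).trans ?_
  congr 1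
  exact funext fun a => upsilonFun_cofaceSimplex n I a

lemma piMap_zero_iota (V : SimplexCategory ⥤ ModuleCat.{0} k) (v : V.obj (SimplexCategory.mk 0)) :
    piMap V 0 (iota V 0 v) = v := by
  have h : (upsilonHom ((Functor.const (Fin 1)).obj (SimplexCategory.mk 0)) :
      SimplexCategory.mk 0 ⟶ SimplexCategory.mk 0) = 𝟙 _ :=
    Subsingleton.elim (α := SimplexCategory.mk 0 ⟶ SimplexCategory.mk 0) _ _
  change V.map (upsilonHom ((Functor.const (Fin 1)).obj (SimplexCategory.mk 0)) :
      SimplexCategory.mk 0 ⟶ SimplexCategory.mk 0) v = v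
  rw [h, V.map_id]
  rfl

lemma mapFun_id (V : SimplexCategory ⥤ ModuleCat.{0} k) {n : ℕ}
    (v : V.obj (SimplexCategory.mk n)) : mapFun V v id = v := by
  refine (map_eq_mapFun V v (𝟙 (SimplexCategory.mk n))).symm.trans ?_
  rw [V.map_id]
  rfl

lemma piMap_iota (V : SimplexCategory ⥤ ModuleCat.{0} k) (n : ℕ)
    (v : V.obj (SimplexCategory.mk n)) :
    piMap V n (iota V n v) = ((-1 : k) ^ (n * (n + 1) / 2)) •
      ∑ I : ∀ j : Fin n, Fin (j.1 + 2),
        ((-1 : k) ^ (∑ j, ((I j) : ℕ))) • mapFun V v (iterFace n I) := by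
  cases n with
  | zero =>
    rw [piMap_zero_iota, Fintype.sum_unique]
    simp only [Finset.univ_eq_empty, Finset.sum_empty, Nat.zero_mul, Nat.zero_div, pow_zero,
      one_smul]
    exact (mapFun_id V v).symm
  | succ n =>
    simp only [piMap, iota_cofaceSimplex]
    rfl

/-- `V(f)` kills the normalized cochains whenever `f` is not injective. -/
lemma map_eq_zero_of_not_injective (V : SimplexCategory ⥤ ModuleCat.{0} k) {n : ℕ}
    (v : V.obj (SimplexCategory.mk (n + 1)))
    (hv : ∀ i : Fin (n + 1), V.map (SimplexCategory.σ i) v = 0) {Δ : SimplexCategory}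
    (f : SimplexCategory.mk (n + 1) ⟶ Δ) (hf : ¬ Function.Injective f.toOrderHom) :
    V.map f v = 0 := by
  obtain ⟨i, θ, rfl⟩ := SimplexCategory.eq_σ_comp_of_not_injective f hf
  rw [V.map_comp]
  exact (congrArg (V.map θ) (hv i)).trans (map_zero _)

lemma piMap_iota_of_normalized (V : SimplexCategory ⥤ ModuleCat.{0} k) (n : ℕ)
    (v : V.obj (SimplexCategory.mk (n + 1)))
    (hv : ∀ i : Fin (n + 1), V.map (SimplexCategory.σ i) v = 0) :
    piMap V (n + 1) (iota V (n + 1) v) = v := by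
  rw [piMap_iota, Finset.sum_eq_single (fun j : Fin (n + 1) => Fin.last (j.1 + 1))]
  · rw [iterFace_top, mapFun_id, smul_smul, ← pow_add]
    have hs : ∑ j : Fin (n + 1), ((Fin.last (j.1 + 1) : Fin (j.1 + 2)) : ℕ) =
        (n + 1) * (n + 1 + 1) / 2 := by
      simp only [Fin.val_last]
      rw [Fin.sum_univ_eq_sum_range (fun i => i + 1) (n + 1)]
      have := Finset.sum_range_succ' (fun i => i) (n + 1)
      rw [add_zero] at this
      rw [← this, Finset.sum_range_id, Nat.add_sub_cancel, mul_comm]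
    rw [hs, ← two_mul, pow_mul, neg_one_sq, one_pow, one_smul]
  · intro I _ hI
    rw [mapFun, dif_pos (monotone_iterFace _ _)]
    refine (congrArg _ (map_eq_zero_of_not_injective V v hv _ fun hinj => hI ?_)).trans (smul_zero _)
    have := SimplexCategory.mono_iff_injective.mpr hinj
    have hid := SimplexCategory.eq_id_of_mono
      (SimplexCategory.mkHom ⟨iterFace (n + 1) I, monotone_iterFace (n + 1) I⟩)
    funext j
    refine eq_top_of_iterFace_eq_id (n + 1) I ?_ j
    funext a
    exact congrArg (fun f : SimplexCategory.mk (n + 1) ⟶ SimplexCategory.mk (n + 1) =>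
      f.toOrderHom a) hid
  · intro h
    exact absurd (Finset.mem_univ _) h

lemma mapFun_add (V : SimplexCategory ⥤ ModuleCat.{0} k) {m n : ℕ}
    (v w : V.obj (SimplexCategory.mk m)) (g : Fin (m + 1) → Fin (n + 1)) :
    mapFun V (v + w) g = mapFun V v g + mapFun V w g := by
  unfold mapFun
  split_ifs
  · exact map_add _ _ _
  · exact (add_zero _).symm

lemma piMap_iota_add (V : SimplexCategory ⥤ ModuleCat.{0} k) (n : ℕ)
    (v w : V.obj (SimplexCategory.mk n)) :
    piMap V n (iota V n (v + w)) = piMap V n (iota V n v) + piMap V n (iota V n w) := by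
  simp only [piMap_iota, mapFun_add, smul_add, Finset.sum_add_distrib]

lemma mapFun_cosimplicialDiff (V : SimplexCategory ⥤ ModuleCat.{0} k) {n : ℕ}
    (u : V.obj (SimplexCategory.mk n)) {g : Fin (n + 2) → Fin (n + 2)} (hg : Monotone g) :
    mapFun V (cosimplicialDiff V n u) g =
      ∑ i : Fin (n + 2), ((-1 : k) ^ (i : ℕ)) • mapFun V u (g ∘ i.succAbove) := by
  rw [mapFun, dif_pos hg, cosimplicialDiff, map_sum]
  refine Finset.sum_congr rfl fun i _ => ?_
  rw [map_smul]
  congr 1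
  refine Eq.trans ?_ (map_eq_mapFun V u (SimplexCategory.δ i ≫ SimplexCategory.mkHom ⟨g, hg⟩))
  rw [V.map_comp]
  rfl

lemma map_δ_mapFun (V : SimplexCategory ⥤ ModuleCat.{0} k) {n : ℕ}
    (u : V.obj (SimplexCategory.mk n)) {g : Fin (n + 1) → Fin (n + 1)} (hg : Monotone g)
    (i : Fin (n + 2)) :
    V.map (SimplexCategory.δ i) (mapFun V u g) = mapFun V u (i.succAbove ∘ g) := by
  rw [mapFun, dif_pos hg]
  refine Eq.trans ?_ (map_eq_mapFun V u (SimplexCategory.mkHom ⟨g, hg⟩ ≫ SimplexCategory.δ i))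
  rw [V.map_comp]
  rfl

lemma piMap_iota_cosimplicialDiff (V : SimplexCategory ⥤ ModuleCat.{0} k) (n : ℕ)
    (u : V.obj (SimplexCategory.mk n)) :
    piMap V (n + 1) (iota V (n + 1) (cosimplicialDiff V n u)) =
      cosimplicialDiff V n (piMap V n (iota V n u)) := by
  have hlast : ∀ (I : ∀ j : Fin n, Fin (j.1 + 2)) (i : Fin (n + 2)),
      iterFace (n + 1) (Fin.snoc (α := fun j : Fin (n + 1) => Fin (j.1 + 2)) I i) ∘
        (Fin.last (n + 1)).succAbove = i.succAbove ∘ iterFace n I := by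
    intro I i
    funext a
    rw [iterFace_snoc, Function.comp_apply, Fin.succAbove_last, Fin.snoc_castSucc]
  have hexp : (n + 1) * (n + 1 + 1) / 2 = n * (n + 1) / 2 + (n + 1) := by
    rw [show (n + 1) * (n + 1 + 1) = n * (n + 1) + (n + 1) * 2 by ring,
      Nat.add_mul_div_right _ _ two_pos]
  rw [piMap_iota, piMap_iota]
  simp only [mapFun_cosimplicialDiff V u (monotone_iterFace _ _), cosimplicialDiff.eq_1 V n (_ • _),
    map_smul, map_sum, map_δ_mapFun V u (monotone_iterFace _ _)]
  simp only [Finset.smul_sum]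
  rw [Finset.sum_comm, Fin.sum_univ_castSucc, Finset.sum_eq_zero, zero_add, sum_snoc,
    Finset.sum_comm]
  · refine Finset.sum_congr rfl fun i _ => Finset.sum_congr rfl fun I _ => ?_
    rw [hlast, sum_val_snoc, hexp]
    simp only [smul_smul, Fin.val_last]
    congr 1
    have h1 : ((-1 : k) ^ (n + 1)) * (-1) ^ (n + 1) = 1 := by
      rw [← mul_pow, neg_one_mul, neg_neg, one_pow]
    rw [pow_add, pow_add _ _ (i : ℕ)]
    linear_combination ((-1 : k) ^ (n * (n + 1) / 2) * (-1) ^ (∑ j, (I j : ℕ)) * (-1) ^ (i : ℕ)) * h1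
  · intro j _
    simp only [smul_comm _ ((-1 : k) ^ (j.castSucc : ℕ))]
    simp only [← Finset.smul_sum]
    rw [sum_iterFace_comp_face_eq_zero, smul_zero, smul_zero]

/-- Every cocycle is cohomologous to a normalized one. -/
lemma exists_normalized_add_cosimplicialDiff (V : SimplexCategory ⥤ ModuleCat.{0} k) (n : ℕ)
    (v : V.obj (SimplexCategory.mk (n + 1))) (hv : cosimplicialDiff V (n + 1) v = 0) :
    ∃ (w : V.obj (SimplexCategory.mk (n + 1))) (u : V.obj (SimplexCategory.mk n)),
      (∀ i : Fin (n + 1), V.map (SimplexCategory.σ i) w = 0) ∧ v = w + cosimplicialDiff V n u := by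
  let X : SimplicialObject (ModuleCat.{0} k)ᵒᵖ := V.op
  let P : X.obj (.op (.mk (n + 1))) ⟶ X.obj (.op (.mk (n + 1))) :=
    (AlgebraicTopology.DoldKan.PInfty (X := X)).f (n + 1)
  have hd : ∀ (m : ℕ) (x : V.obj (SimplexCategory.mk m)),
      ((AlgebraicTopology.AlternatingFaceMapComplex.obj X).d (m + 1) m).unop x =
        cosimplicialDiff V m x := by
    intro m x
    have hsum : ((AlgebraicTopology.AlternatingFaceMapComplex.obj X).d (m + 1) m).unop =
        ∑ i : Fin (m + 2), (-1 : ℤ) ^ (i : ℕ) • V.map (SimplexCategory.δ i) := by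
      rw [AlgebraicTopology.AlternatingFaceMapComplex.obj_d_eq, unop_sum]
      rfl
    have hx := congrArg (fun f : V.obj (.mk m) ⟶ V.obj (.mk (m + 1)) => f.hom x) hsum
    refine hx.trans ?_
    rw [ModuleCat.hom_sum, LinearMap.sum_apply]
    refine Finset.sum_congr rfl fun i _ => ?_
    rw [ModuleCat.hom_zsmul, LinearMap.smul_apply, ← Int.cast_smul_eq_zsmul k]
    push_cast
    rfl
  have hcomm := (AlgebraicTopology.DoldKan.homotopyPInftyToId X).comm (n + 1)
  rw [Homotopy.dNext_succ_chainComplex, Homotopy.prevD_chainComplex] at hcomm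
  let h : V.obj (.mk (n + 1)) ⟶ V.obj (.mk n) :=
    ((AlgebraicTopology.DoldKan.homotopyPInftyToId X).hom n (n + 1)).unop
  let h' : V.obj (.mk (n + 2)) ⟶ V.obj (.mk (n + 1)) :=
    ((AlgebraicTopology.DoldKan.homotopyPInftyToId X).hom (n + 1) (n + 2)).unop
  have hP : P.unop v =
      h' (cosimplicialDiff V (n + 1) v) + cosimplicialDiff V n (h v) + v := by
    rw [← hd n, ← hd (n + 1), add_comm (h' _)]
    exact congrArg (fun f => f.unop v) hcomm
  refine ⟨P.unop v, -h v, fun i => ?_, ?_⟩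
  · exact congrArg (fun f => f.unop v) (AlgebraicTopology.DoldKan.σ_comp_PInfty X i)
  · rw [hP, hv, map_zero, zero_add]
    simp only [cosimplicialDiff, map_neg, smul_neg, Finset.sum_neg_distrib]
    abel

/-- `π∘ι : C•(V) → C•(V)` preserves the normalized subcomplex `C̄•(V)` and
restricts to the identity on it; consequently it induces the identity on cohomology. -/
theorem pi_iota_identity_on_normalized (V : SimplexCategory ⥤ ModuleCat k) :
    (∀ v : V.obj (SimplexCategory.mk 0), piMap V 0 (iota V 0 v) = v) ∧
    (∀ (n : ℕ) (v : V.obj (SimplexCategory.mk (n + 1))),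
      (∀ i : Fin (n + 1), V.map (SimplexCategory.σ i) v = 0) →
        piMap V (n + 1) (iota V (n + 1) v) = v) ∧
    -- consequently, `π∘ι` induces the identity map on the cohomology of `C•(V)`:
    (∀ v : V.obj (SimplexCategory.mk 0),
      cosimplicialDiff V 0 v = 0 → piMap V 0 (iota V 0 v) = v) ∧
    (∀ (n : ℕ) (v : V.obj (SimplexCategory.mk (n + 1))),
      cosimplicialDiff V (n + 1) v = 0 →
        ∃ u : V.obj (SimplexCategory.mk n),
          piMap V (n + 1) (iota V (n + 1) v) - v = cosimplicialDiff V n u) := by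
  refine ⟨piMap_zero_iota V, piMap_iota_of_normalized V, fun v _ => piMap_zero_iota V v,
    fun n v hv => ?_⟩
  obtain ⟨w, u, hw, rfl⟩ := exists_normalized_add_cosimplicialDiff V n v hv
  refine ⟨piMap V n (iota V n u) - u, ?_⟩
  rw [piMap_iota_add, piMap_iota_of_normalized V n w hw, piMap_iota_cosimplicialDiff]
  simp only [cosimplicialDiff, map_sub, smul_sub, Finset.sum_sub_distrib]
  abel
end
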